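/- arXiv:1505.01670 — 11 statements merged into one kernel-verified Lean document; each statement's English description precedes it below -/
import Mathlib

section
/- Let f be a continuous subnorm on the quaternions ℍ (viewed as a real algebra). Then for every q ∈ ℍ, the sequence f(q^k)^{1/k} converges to ‖q‖ as k → ∞, where ‖q‖ is the Euclidean norm of q. -/
/-- A continuous, absolutely homogeneous function which is positive away from zero is equivalent
to the norm. -/
theorem exists_norm_bounds_of_continuous_homogeneous {E : Type*} [NormedAddCommGroup E]
    [NormedSpace ℝ E] [ProperSpace E] [Nontrivial E] (f : E → ℝ) (hf_cont : Continuous f)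
    (hf_pos : ∀ x : E, x ≠ 0 → 0 < f x) (hf_hom : ∀ (α : ℝ) (x : E), f (α • x) = |α| * f x) :
    ∃ m M : ℝ, 0 < m ∧ 0 < M ∧ ∀ x : E, m * ‖x‖ ≤ f x ∧ f x ≤ M * ‖x‖ := by
  have hK : IsCompact (Metric.sphere (0 : E) 1) := isCompact_sphere 0 1
  have hne : (Metric.sphere (0 : E) 1).Nonempty := NormedSpace.sphere_nonempty.2 zero_le_one
  obtain ⟨a, ha, hmin⟩ := hK.exists_isMinOn hne hf_cont.continuousOn
  obtain ⟨b, hb, hmax⟩ := hK.exists_isMaxOn hne hf_cont.continuousOn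
  refine ⟨f a, f b, hf_pos a (ne_zero_of_mem_unit_sphere ⟨a, ha⟩),
    hf_pos b (ne_zero_of_mem_unit_sphere ⟨b, hb⟩), fun x => ?_⟩
  rcases eq_or_ne x 0 with rfl | hx
  · have h0 : f 0 = 0 := by simpa using hf_hom 0 0
    simp [h0]
  have hx' : 0 < ‖x‖ := norm_pos_iff.2 hx
  have hu : ‖x‖⁻¹ • x ∈ Metric.sphere (0 : E) 1 := by simp [norm_smul, hx'.ne']
  have hfx : f x = f (‖x‖⁻¹ • x) * ‖x‖ := by
    rw [hf_hom, abs_of_pos (inv_pos.2 hx')]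
    field_simp
  rw [hfx]
  exact ⟨mul_le_mul_of_nonneg_right (hmin hu) hx'.le, mul_le_mul_of_nonneg_right (hmax hu) hx'.le⟩

theorem tendsto_mul_pow_rpow_inv {c r : ℝ} (hc : 0 < c) (hr : 0 ≤ r) :
    Filter.Tendsto (fun k : ℕ => (c * r ^ k) ^ ((k : ℝ)⁻¹)) Filter.atTop (nhds r) := by
  have h : Filter.Tendsto (fun k : ℕ => c ^ ((k : ℝ)⁻¹) * r) Filter.atTop (nhds (c ^ (0 : ℝ) * r)) :=
    ((Real.continuousAt_const_rpow hc.ne').tendsto.comp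
      (tendsto_inv_atTop_nhds_zero_nat (𝕜 := ℝ))).mul_const r
  rw [Real.rpow_zero, one_mul] at h
  refine h.congr' ?_
  filter_upwards [Filter.eventually_ne_atTop 0] with k hk
  rw [Real.mul_rpow hc.le (pow_nonneg hr k), Real.pow_rpow_inv_natCast hr hk]

/-- Gelfand formula for continuous subnorms on the quaternions: if `f` is a
continuous subnorm on `ℍ` (as a real algebra), then `f(q^k)^(1/k) → ‖q‖`
as `k → ∞`, where `‖q‖` is the Euclidean norm. -/
theorem gelfand_formula_quaternion (f : Quaternion ℝ → ℝ)
    (hf_cont : Continuous f)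
    (hf_pos : ∀ q : Quaternion ℝ, q ≠ 0 → 0 < f q)
    (hf_hom : ∀ (α : ℝ) (q : Quaternion ℝ), f (α • q) = |α| * f q) :
    ∀ q : Quaternion ℝ, Filter.Tendsto (fun k : ℕ => f (q ^ k) ^ ((k : ℝ)⁻¹))
      Filter.atTop (nhds ‖q‖) := by
  intro q
  have : ProperSpace (Quaternion ℝ) := FiniteDimensional.proper_real _
  obtain ⟨m, M, hm, hM, h⟩ :=
    exists_norm_bounds_of_continuous_homogeneous f hf_cont hf_pos hf_hom
  have hq : 0 ≤ ‖q‖ := norm_nonneg q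
  refine tendsto_of_tendsto_of_tendsto_of_le_of_le (tendsto_mul_pow_rpow_inv hm hq)
    (tendsto_mul_pow_rpow_inv hM hq) (fun k => ?_) (fun k => ?_)
  · have hk := (h (q ^ k)).1
    rw [norm_pow] at hk
    exact Real.rpow_le_rpow (by positivity) hk (by positivity)
  · have hk := h (q ^ k)
    rw [norm_pow] at hk
    exact Real.rpow_le_rpow (le_trans (by positivity) hk.1) hk.2 (by positivity)
end

section
/- Let g be a subnorm on the quaternions ℍ, and suppose g is equivalent to some continuous subnorm f on ℍ, i.e. there exist constants μ > 0 and ν > 0 with μ·f(q) ≤ g(q) ≤ ν·f(q) for all q ∈ ℍ. Then for every q ∈ ℍ, the sequence g(q^k)^{1/k} converges to ‖q‖ as k → ∞. -/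
open Filter Topology

/-- A continuous, absolutely homogeneous function that is positive off the origin of a nontrivial
finite-dimensional real normed space is equivalent to the norm. -/
theorem exists_mul_norm_le_and_le_mul_norm {E : Type*} [NormedAddCommGroup E] [NormedSpace ℝ E]
    [FiniteDimensional ℝ E] [Nontrivial E] {f : E → ℝ} (hf : Continuous f)
    (hpos : ∀ x, x ≠ 0 → 0 < f x) (hhom : ∀ (α : ℝ) x, f (α • x) = |α| * f x) :
    ∃ m M : ℝ, 0 < m ∧ 0 < M ∧ ∀ x, m * ‖x‖ ≤ f x ∧ f x ≤ M * ‖x‖ := by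
  have : ProperSpace E := FiniteDimensional.proper ℝ E
  have hne : (Metric.sphere (0 : E) 1).Nonempty := NormedSpace.sphere_nonempty.2 zero_le_one
  have hsphere : ∀ x ∈ Metric.sphere (0 : E) 1, 0 < f x := fun x hx ↦
    hpos x (ne_zero_of_mem_unit_sphere ⟨x, hx⟩)
  obtain ⟨a, ha, hmin⟩ := (isCompact_sphere (0 : E) 1).exists_isMinOn hne hf.continuousOn
  obtain ⟨b, hb, hmax⟩ := (isCompact_sphere (0 : E) 1).exists_isMaxOn hne hf.continuousOn
  refine ⟨f a, f b, hsphere a ha, hsphere b hb, fun x ↦ ?_⟩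
  rcases eq_or_ne x 0 with rfl | hx
  · have h0 : f 0 = 0 := by simpa using hhom 0 0
    simp [h0]
  · have hu : ‖x‖⁻¹ • x ∈ Metric.sphere (0 : E) 1 := by
      simp [norm_smul, norm_ne_zero_iff.2 hx]
    have hfx : f x = f (‖x‖⁻¹ • x) * ‖x‖ := by
      rw [hhom, abs_of_nonneg (by positivity)]
      field_simp [norm_ne_zero_iff.2 hx]
    rw [hfx]
    exact ⟨mul_le_mul_of_nonneg_right (hmin hu) (norm_nonneg x),
      mul_le_mul_of_nonneg_right (hmax hu) (norm_nonneg x)⟩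

/-- If `u k` is comparable to `r ^ k` up to positive constants, then `u k ^ (1 / k)` tends to
`r`. -/
theorem tendsto_rpow_inv_natCast_of_mul_pow_le {u : ℕ → ℝ} {r c C : ℝ} (hr : 0 ≤ r)
    (hc : 0 < c) (hC : 0 < C) (hlow : ∀ k, c * r ^ k ≤ u k) (hupp : ∀ k, u k ≤ C * r ^ k) :
    Tendsto (fun k : ℕ ↦ u k ^ ((k : ℝ)⁻¹)) atTop (𝓝 r) := by
  have hlim : ∀ d : ℝ, 0 < d →
      Tendsto (fun k : ℕ ↦ (d * r ^ k) ^ ((k : ℝ)⁻¹)) atTop (𝓝 r) := fun d hd ↦ by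
    have h : Tendsto (fun k : ℕ ↦ d ^ ((k : ℝ)⁻¹) * r) atTop (𝓝 r) := by
      simpa using (tendsto_const_nhds.rpow tendsto_inv_atTop_nhds_zero_nat
        (Or.inl hd.ne')).mul_const r
    refine h.congr' ?_
    filter_upwards [eventually_ne_atTop 0] with k hk
    rw [Real.mul_rpow hd.le (pow_nonneg hr k), Real.pow_rpow_inv_natCast hr hk]
  refine tendsto_of_tendsto_of_tendsto_of_le_of_le (hlim c hc) (hlim C hC) (fun k ↦ ?_)
    fun k ↦ ?_
  · exact Real.rpow_le_rpow (by positivity) (hlow k) (by positivity)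
  · exact Real.rpow_le_rpow ((by positivity : 0 ≤ c * r ^ k).trans (hlow k)) (hupp k)
      (by positivity)

/-- If a subnorm `g` on the quaternions is equivalent to a continuous subnorm
`f`, then `g(q^k)^(1/k) → ‖q‖` as `k → ∞` for every quaternion `q`. -/
theorem gelfand_formula_equiv_subnorm_quaternion
    (g f : Quaternion ℝ → ℝ)
    (hg_pos : ∀ q : Quaternion ℝ, q ≠ 0 → 0 < g q)
    (hg_hom : ∀ (α : ℝ) (q : Quaternion ℝ), g (α • q) = |α| * g q)
    (hf_cont : Continuous f)
    (hf_pos : ∀ q : Quaternion ℝ, q ≠ 0 → 0 < f q)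
    (hf_hom : ∀ (α : ℝ) (q : Quaternion ℝ), f (α • q) = |α| * f q)
    (μ ν : ℝ) (hμ : 0 < μ) (hν : 0 < ν)
    (h_equiv : ∀ q : Quaternion ℝ, μ * f q ≤ g q ∧ g q ≤ ν * f q) :
    ∀ q : Quaternion ℝ, Filter.Tendsto (fun k : ℕ => g (q ^ k) ^ ((k : ℝ)⁻¹))
      Filter.atTop (nhds ‖q‖) := by
  intro q
  obtain ⟨m, M, hm, hM, hbound⟩ := exists_mul_norm_le_and_le_mul_norm hf_cont hf_pos hf_hom
  refine tendsto_rpow_inv_natCast_of_mul_pow_le (norm_nonneg q) (mul_pos hμ hm) (mul_pos hν hM)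
    (fun k ↦ ?_) fun k ↦ ?_
  · rw [← norm_pow, mul_assoc]
    exact (mul_le_mul_of_nonneg_left (hbound _).1 hμ.le).trans (h_equiv _).1
  · rw [← norm_pow, mul_assoc]
    exact (h_equiv _).2.trans (mul_le_mul_of_nonneg_left (hbound _).2 hν.le)
end

section
/- Let f be a continuous subnorm on ℂ (as a real algebra), and let φ : ℝ → ℝ be additive and π-periodic. Then the function g_φ(z) = f(z)·e^{φ(Arg z)} is a subnorm on ℂ: g_φ(z) > 0 for all z ≠ 0, and g_φ(α·z) = |α|·g_φ(z) for all α ∈ ℝ and z ∈ ℂ. -/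
/-- The principal argument of a complex number, normalized to lie in `[0, 2π)`,
with `Arg 0 = 0`. -/
noncomputable def Arg2pi (z : ℂ) : ℝ :=
  if Complex.arg z < 0 then Complex.arg z + 2 * Real.pi else Complex.arg z

theorem map_Arg2pi_eq_map_arg {φ : ℝ → ℝ} (hφ : ∀ x : ℝ, φ (x + Real.pi) = φ x) (z : ℂ) :
    φ (Arg2pi z) = φ (Complex.arg z) := by
  unfold Arg2pi
  split_ifs
  · rw [two_mul, ← add_assoc, hφ, hφ]
  · rfl

theorem map_arg_neg {φ : ℝ → ℝ} (hφ : ∀ x : ℝ, φ (x + Real.pi) = φ x) {z : ℂ} (hz : z ≠ 0) :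
    φ (Complex.arg (-z)) = φ (Complex.arg z) := by
  have hsub (h : Complex.arg (-z) = Complex.arg z - Real.pi) :
      φ (Complex.arg (-z)) = φ (Complex.arg z) := by
    rw [h, ← hφ (Complex.arg z - Real.pi), sub_add_cancel]
  have hadd (h : Complex.arg (-z) = Complex.arg z + Real.pi) :
      φ (Complex.arg (-z)) = φ (Complex.arg z) := by
    rw [h, hφ]
  rcases lt_trichotomy z.im 0 with him | him | him
  · exact hadd (Complex.arg_neg_eq_arg_add_pi_iff.2 (.inl him))
  · rcases lt_trichotomy z.re 0 with hre | hre | hre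
    · exact hsub (Complex.arg_neg_eq_arg_sub_pi_iff.2 (.inr ⟨him, hre⟩))
    · exact absurd (Complex.ext hre him) hz
    · exact hadd (Complex.arg_neg_eq_arg_add_pi_iff.2 (.inr ⟨him, hre⟩))
  · exact hsub (Complex.arg_neg_eq_arg_sub_pi_iff.2 (.inl him))

theorem map_Arg2pi_smul {φ : ℝ → ℝ} (hφ : ∀ x : ℝ, φ (x + Real.pi) = φ x) {α : ℝ} (hα : α ≠ 0)
    (z : ℂ) : φ (Arg2pi (α • z)) = φ (Arg2pi z) := by
  rw [map_Arg2pi_eq_map_arg hφ, map_Arg2pi_eq_map_arg hφ, Complex.real_smul]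
  rcases eq_or_ne z 0 with rfl | hz
  · rw [mul_zero]
  rcases lt_or_gt_of_ne hα with h | h
  · rw [← map_arg_neg hφ hz, ← Complex.arg_real_mul (-z) (neg_pos.2 h), Complex.ofReal_neg, neg_mul_neg]
  · rw [Complex.arg_real_mul z h]

/-- If `f` is a continuous subnorm on `ℂ` and `φ : ℝ → ℝ` is additive and
`π`-periodic, then `g_φ(z) = f(z)·e^{φ(Arg z)}` is a subnorm on `ℂ`. -/
theorem g_phi_is_subnorm (f : ℂ → ℝ)
    (hf_cont : Continuous f)
    (hf_pos : ∀ z : ℂ, z ≠ 0 → 0 < f z)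
    (hf_hom : ∀ (α : ℝ) (z : ℂ), f (α • z) = |α| * f z)
    (φ : ℝ → ℝ)
    (hφ_add : ∀ x y : ℝ, φ (x + y) = φ x + φ y)
    (hφ_per : ∀ x : ℝ, φ (x + Real.pi) = φ x) :
    (∀ z : ℂ, z ≠ 0 → 0 < f z * Real.exp (φ (Arg2pi z))) ∧
    (∀ (α : ℝ) (z : ℂ),
      f (α • z) * Real.exp (φ (Arg2pi (α • z)))
        = |α| * (f z * Real.exp (φ (Arg2pi z)))) := by
  refine ⟨fun z hz => mul_pos (hf_pos z hz) (Real.exp_pos _), fun α z => ?_⟩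
  rcases eq_or_ne α 0 with rfl | hα
  · simp only [hf_hom, abs_zero, zero_mul]
  · rw [hf_hom, map_Arg2pi_smul hφ_per hα, mul_assoc]
end

section
/- Let f be a continuous subnorm on ℂ (as a real algebra), and let φ : ℝ → ℝ be additive, π-periodic, and discontinuous. Then the function g_φ(z) = f(z)·e^{φ(Arg z)} is discontinuous at every point of ℂ; i.e., for every z₀ ∈ ℂ, g_φ is not continuous at z₀. -/
open Real in
lemma Function.Periodic.apply_Arg2pi_mul_exp {φ : ℝ → ℝ} (hφ : Function.Periodic φ π)
    {r : ℝ} (hr : 0 < r) (θ : ℝ) :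
    φ (Arg2pi (r * Complex.exp (θ * Complex.I))) = φ θ := by
  have h2 : Function.Periodic φ (2 * π) := by simpa using hφ.nat_mul 2
  have harg (z : ℂ) : φ (Arg2pi z) = φ z.arg := by
    unfold Arg2pi
    split_ifs
    · exact h2 _
    · rfl
  rw [harg, Complex.arg_real_mul _ hr, Complex.arg_exp_mul_I, toIocMod]
  exact h2.sub_zsmul_eq _

lemma AddMonoidHom.eq_zero_of_forall_le {G : Type*} [AddGroup G] (ψ : G →+ ℝ) {C : ℝ}
    (h : ∀ x, ψ x ≤ C) : ψ = 0 := by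
  have hle (x : G) : ψ x ≤ 0 := by
    by_contra! hx
    obtain ⟨n, hn⟩ := Archimedean.arch (C + 1) hx
    have := h (n • x)
    rw [map_nsmul] at this
    linarith
  ext x
  have := hle (-x)
  rw [map_neg] at this
  exact le_antisymm (hle x) (by simpa using this)

/-- If `f` is a continuous subnorm on `ℂ` and `φ : ℝ → ℝ` is additive,
`π`-periodic and discontinuous, then `g_φ(z) = f(z)·e^{φ(Arg z)}` is
discontinuous at every point of `ℂ`. -/
theorem g_phi_discontinuous_everywhere (f : ℂ → ℝ)
    (hf_cont : Continuous f)
    (hf_pos : ∀ z : ℂ, z ≠ 0 → 0 < f z)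
    (hf_hom : ∀ (α : ℝ) (z : ℂ), f (α • z) = |α| * f z)
    (φ : ℝ → ℝ)
    (hφ_add : ∀ x y : ℝ, φ (x + y) = φ x + φ y)
    (hφ_per : ∀ x : ℝ, φ (x + Real.pi) = φ x)
    (hφ_discont : ¬ Continuous φ) :
    ∀ z₀ : ℂ, ¬ ContinuousAt (fun z : ℂ => f z * Real.exp (φ (Arg2pi z))) z₀ := by
  intro z₀ hg
  let ψ : ℝ →+ ℝ := AddMonoidHom.mk' φ hφ_add
  have hper : Function.Periodic φ Real.pi := hφ_per
  rcases eq_or_ne z₀ 0 with rfl | hz₀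
  · have hf0 : f 0 = 0 := by simpa using hf_hom 0 0
    obtain ⟨w, hw, hmin⟩ := (isCompact_sphere (0 : ℂ) 1).exists_isMinOn
      (NormedSpace.sphere_nonempty.2 zero_le_one) hf_cont.continuousOn
    have hm : 0 < f w := hf_pos w (ne_zero_of_mem_unit_sphere ⟨w, hw⟩)
    obtain ⟨δ, hδ, hball⟩ := Metric.continuousAt_iff.1 hg 1 one_pos
    have hr : 0 < δ / 2 := half_pos hδ
    have hbound (θ : ℝ) : ψ θ ≤ 1 / (δ / 2 * f w) := by
      have hlt := @hball ((δ / 2 : ℝ) * Complex.exp (θ * Complex.I)) (by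
        simp only [dist_zero_right, norm_mul, Complex.norm_real, Complex.norm_exp_ofReal_mul_I,
          mul_one, Real.norm_eq_abs, abs_of_pos hr]
        linarith)
      simp only [hf0, zero_mul, dist_zero_right, hper.apply_Arg2pi_mul_exp hr] at hlt
      have hsc := hf_hom (δ / 2) (Complex.exp (θ * Complex.I))
      rw [Complex.real_smul, abs_of_pos hr] at hsc
      rw [hsc] at hlt
      have hmw : f w ≤ f (Complex.exp (θ * Complex.I)) :=
        hmin (by simp [Complex.norm_exp_ofReal_mul_I])
      have hexp : φ θ ≤ Real.exp (φ θ) := by linarith [Real.add_one_le_exp (φ θ)]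
      refine hexp.trans ((le_div_iff₀' (by positivity)).2 ?_)
      calc δ / 2 * f w * Real.exp (φ θ)
          ≤ δ / 2 * f (Complex.exp (θ * Complex.I)) * Real.exp (φ θ) := by gcongr
        _ ≤ 1 := (le_abs_self _).trans hlt.le
    have hψ := ψ.eq_zero_of_forall_le hbound
    exact hφ_discont (show Continuous ψ by rw [hψ]; exact continuous_zero)
  · have hr : 0 < ‖z₀‖ := norm_pos_iff.2 hz₀
    have hlog : ContinuousAt (fun z => φ (Arg2pi z)) z₀ := by
      have hquot := (hg.div hf_cont.continuousAt (hf_pos z₀ hz₀).ne').log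
        (by simp [(hf_pos z₀ hz₀).ne'])
      refine hquot.congr ?_
      filter_upwards [isOpen_ne.mem_nhds hz₀] with z hz
      simp [mul_div_cancel_left₀ _ (hf_pos z hz).ne']
    have hψ : ContinuousAt ψ z₀.arg := by
      rw [← Complex.norm_mul_exp_arg_mul_I z₀] at hlog
      have hcomp := hlog.comp_of_eq
        (f := fun θ : ℝ => (‖z₀‖ : ℂ) * Complex.exp (θ * Complex.I)) (x := z₀.arg)
        (by fun_prop) rfl
      exact hcomp.congr (.of_forall fun θ => hper.apply_Arg2pi_mul_exp hr θ)
    have hzero : ContinuousAt ψ 0 := by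
      have hshift : ContinuousAt (fun x => ψ (z₀.arg + x) - ψ z₀.arg) 0 :=
        (hψ.comp_of_eq (f := fun x => z₀.arg + x) (by fun_prop) (add_zero _)).sub
          continuousAt_const
      simpa using hshift
    exact hφ_discont (continuous_of_continuousAt_zero ψ hzero)
end

section
/- Let f be a continuous subnorm on the quaternions ℍ (as a real algebra). Then f is stable if and only if f majorizes the Euclidean norm, i.e., there exists σ > 0 with f(q^k) ≤ σ·f(q)^k for all q ∈ ℍ and all integers k ≥ 1 if and only if f(q) ≥ ‖q‖ for all q ∈ ℍ. -/
/-- A continuous subnorm on a finite-dimensional normed space is bounded above and below by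
positive multiples of the norm. -/
theorem exists_norm_equiv_of_continuous_subnorm {E : Type*} [NormedAddCommGroup E]
    [NormedSpace ℝ E] [FiniteDimensional ℝ E] [Nontrivial E] {f : E → ℝ}
    (hf_cont : Continuous f) (hf_pos : ∀ x, x ≠ 0 → 0 < f x)
    (hf_hom : ∀ (α : ℝ) (x : E), f (α • x) = |α| * f x) :
    ∃ m M : ℝ, 0 < m ∧ 0 < M ∧ ∀ x, m * ‖x‖ ≤ f x ∧ f x ≤ M * ‖x‖ := by
  have : ProperSpace E := FiniteDimensional.proper ℝ E
  have hK : IsCompact (Metric.sphere (0 : E) 1) := isCompact_sphere 0 1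
  have hne : (Metric.sphere (0 : E) 1).Nonempty := NormedSpace.sphere_nonempty.2 zero_le_one
  obtain ⟨a, ha, hmin⟩ := hK.exists_isMinOn hne hf_cont.continuousOn
  obtain ⟨b, hb, hmax⟩ := hK.exists_isMaxOn hne hf_cont.continuousOn
  have hpos : ∀ x ∈ Metric.sphere (0 : E) 1, 0 < f x := fun x hx =>
    hf_pos x (ne_zero_of_mem_sphere one_ne_zero ⟨x, hx⟩)
  refine ⟨f a, f b, hpos a ha, hpos b hb, fun x => ?_⟩
  rcases eq_or_ne x 0 with rfl | hx
  · have h0 : f 0 = 0 := by simpa using hf_hom 0 0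
    simp [h0]
  · have hu : ‖x‖⁻¹ • x ∈ Metric.sphere (0 : E) 1 := by
      simp [norm_smul, hx]
    have hfx : f x = f (‖x‖⁻¹ • x) * ‖x‖ := by
      rw [hf_hom, abs_of_nonneg (by positivity)]
      field_simp
    rw [hfx]
    exact ⟨mul_le_mul_of_nonneg_right (hmin hu) (norm_nonneg x),
      mul_le_mul_of_nonneg_right (hmax hu) (norm_nonneg x)⟩

/-- A real number whose powers are bounded above by a fixed bound is at most one. -/
theorem le_one_of_forall_pow_le {r C : ℝ} (h : ∀ k : ℕ, 1 ≤ k → r ^ k ≤ C) : r ≤ 1 := by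
  by_contra! hr
  obtain ⟨n, hn⟩ := pow_unbounded_of_one_lt C hr
  exact (hn.trans_le (pow_le_pow_right₀ hr.le n.le_succ)).not_ge (h (n + 1) n.succ_pos)

/-- A continuous subnorm on the quaternions is stable if and only if it
majorizes the Euclidean norm. -/
theorem stable_iff_radially_dominant_quaternion (f : Quaternion ℝ → ℝ)
    (hf_cont : Continuous f)
    (hf_pos : ∀ q : Quaternion ℝ, q ≠ 0 → 0 < f q)
    (hf_hom : ∀ (α : ℝ) (q : Quaternion ℝ), f (α • q) = |α| * f q) :
    (∃ σ : ℝ, 0 < σ ∧ ∀ (q : Quaternion ℝ) (k : ℕ), 1 ≤ k → f (q ^ k) ≤ σ * f q ^ k) ↔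
    (∀ q : Quaternion ℝ, ‖q‖ ≤ f q) := by
  obtain ⟨m, M, hm, hM, hbound⟩ :=
    exists_norm_equiv_of_continuous_subnorm hf_cont hf_pos hf_hom
  constructor
  · rintro ⟨σ, -, hstable⟩ q
    rcases eq_or_ne q 0 with rfl | hq
    · simpa using (hbound 0).1
    · have hfq := hf_pos q hq
      rw [← div_le_one hfq]
      refine le_one_of_forall_pow_le (C := σ / m) fun k hk => ?_
      rw [div_pow, div_le_div_iff₀ (pow_pos hfq k) hm, ← norm_pow, mul_comm]
      exact (hbound (q ^ k)).1.trans (hstable q k hk)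
  · refine fun h => ⟨M, hM, fun q k _ => (hbound (q ^ k)).2.trans ?_⟩
    rw [norm_pow]
    gcongr
    exact h q
end

section
/- Let u > 0 and v > 0, and consider the weighted sup norm on ℂ defined by ‖z‖_{w,∞} = max{u·|α|, v·|β|} for z = α + iβ. Then ‖·‖_{w,∞} is a stable subnorm on ℂ (there exists σ > 0 with ‖z^k‖_{w,∞} ≤ σ·‖z‖_{w,∞}^k for all z and all k ≥ 1) if and only if u²·v² ≥ u² + v². -/
/-- The weighted sup norm `‖z‖_{w,∞} = max{u·|Re z|, v·|Im z|}` on `ℂ` is a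
stable subnorm if and only if `u²·v² ≥ u² + v²`. -/
theorem weighted_sup_norm_stable_iff (u v : ℝ) (hu : 0 < u) (hv : 0 < v) :
    (∃ σ : ℝ, 0 < σ ∧ ∀ (z : ℂ) (k : ℕ), 1 ≤ k →
      max (u * |(z ^ k).re|) (v * |(z ^ k).im|)
        ≤ σ * (max (u * |z.re|) (v * |z.im|)) ^ k) ↔
    u ^ 2 + v ^ 2 ≤ u ^ 2 * v ^ 2 := by
  constructor
  · rintro ⟨σ, -, h⟩
    by_contra! hlt
    -- The corner of the unit ball has modulus greater than one, so its powers are unbounded.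
    set z : ℂ := ⟨1 / u, 1 / v⟩ with hz
    have hM : max (u * |z.re|) (v * |z.im|) = 1 := by
      simp [hz, abs_of_pos hu, abs_of_pos hv, hu.ne', hv.ne']
    have hnorm : 1 < ‖z‖ := by
      have hsq : ‖z‖ ^ 2 = (u ^ 2 + v ^ 2) / (u ^ 2 * v ^ 2) := by
        rw [Complex.sq_norm, Complex.normSq_apply]
        simp only [hz]
        field_simp
        ring
      have : 1 < ‖z‖ ^ 2 := by
        rw [hsq, one_lt_div (by positivity)]
        exact hlt
      nlinarith [norm_nonneg z]
    obtain ⟨k, hk⟩ := pow_unbounded_of_one_lt (σ / u + σ / v) hnorm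
    have hbound := h z (k + 1) (by omega)
    rw [hM, one_pow, mul_one, max_le_iff] at hbound
    have hre : |(z ^ (k + 1)).re| ≤ σ / u := by
      rw [le_div_iff₀ hu, mul_comm]
      exact hbound.1
    have him : |(z ^ (k + 1)).im| ≤ σ / v := by
      rw [le_div_iff₀ hv, mul_comm]
      exact hbound.2
    have hle := Complex.norm_le_abs_re_add_abs_im (z ^ (k + 1))
    rw [norm_pow] at hle
    have hmono : ‖z‖ ^ k ≤ ‖z‖ ^ (k + 1) := pow_le_pow_right₀ hnorm.le (Nat.le_succ k)
    linarith
  · intro h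
    refine ⟨u + v, by positivity, fun z k _ => ?_⟩
    set M := max (u * |z.re|) (v * |z.im|) with hM
    have hM0 : 0 ≤ M := le_max_of_le_left (by positivity)
    have hre : u ^ 2 * z.re ^ 2 ≤ M ^ 2 := by
      rw [← sq_abs z.re, ← mul_pow]
      exact pow_le_pow_left₀ (by positivity) (le_max_left _ _) 2
    have him : v ^ 2 * z.im ^ 2 ≤ M ^ 2 := by
      rw [← sq_abs z.im, ← mul_pow]
      exact pow_le_pow_left₀ (by positivity) (le_max_right _ _) 2
    have hnorm : ‖z‖ ≤ M := by
      refine (sq_le_sq₀ (norm_nonneg z) hM0).1 ?_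
      rw [Complex.sq_norm, Complex.normSq_apply]
      have huv : 0 < u ^ 2 * v ^ 2 := by positivity
      refine le_of_mul_le_mul_left ?_ huv
      calc u ^ 2 * v ^ 2 * (z.re * z.re + z.im * z.im)
          = v ^ 2 * (u ^ 2 * z.re ^ 2) + u ^ 2 * (v ^ 2 * z.im ^ 2) := by ring
        _ ≤ v ^ 2 * M ^ 2 + u ^ 2 * M ^ 2 := by gcongr
        _ = (u ^ 2 + v ^ 2) * M ^ 2 := by ring
        _ ≤ u ^ 2 * v ^ 2 * M ^ 2 := by gcongr
    have hpow : ‖z ^ k‖ ≤ M ^ k := by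
      rw [norm_pow]
      gcongr
    have hMk : 0 ≤ M ^ k := pow_nonneg hM0 k
    refine max_le ?_ ?_
    · exact mul_le_mul (by linarith) ((Complex.abs_re_le_norm _).trans hpow)
        (abs_nonneg _) (by positivity)
    · exact mul_le_mul (by linarith) ((Complex.abs_im_le_norm _).trans hpow)
        (abs_nonneg _) (by positivity)
end

section
/- Let u > 0 and v > 0, and consider the weighted ℓ₁ norm on ℂ defined by ‖z‖_{w,1} = u·|α| + v·|β| for z = α + iβ. Then ‖·‖_{w,1} is a stable subnorm on ℂ (there exists σ > 0 with ‖z^k‖_{w,1} ≤ σ·‖z‖_{w,1}^k for all z and all k ≥ 1) if and only if u ≥ 1 and v ≥ 1. -/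
/-- A nonnegative real whose powers, along a positive arithmetic progression of exponents, stay
bounded away from zero is at least one. -/
lemma one_le_of_forall_le_mul_pow {b c σ : ℝ} {d : ℕ} (hd : 1 ≤ d) (hb : 0 ≤ b) (hc : 0 < c)
    (hσ : 0 < σ) (h : ∀ n : ℕ, c ≤ σ * b ^ (d * (n + 1))) : 1 ≤ b := by
  by_contra! hb1
  obtain ⟨n, hn⟩ := exists_pow_lt_of_lt_one (div_pos hc hσ) hb1
  have hle : b ^ (d * (n + 1)) ≤ b ^ n := pow_le_pow_of_le_one hb hb1.le (by nlinarith)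
  rw [lt_div_iff₀ hσ] at hn
  nlinarith [h n]

/-- The weighted `ℓ₁` norm `‖z‖_{w,1} = u·|Re z| + v·|Im z|` on `ℂ` is a
stable subnorm if and only if `u ≥ 1` and `v ≥ 1`. -/
theorem weighted_l1_norm_stable_iff (u v : ℝ) (hu : 0 < u) (hv : 0 < v) :
    (∃ σ : ℝ, 0 < σ ∧ ∀ (z : ℂ) (k : ℕ), 1 ≤ k →
      u * |(z ^ k).re| + v * |(z ^ k).im|
        ≤ σ * (u * |z.re| + v * |z.im|) ^ k) ↔
    (1 ≤ u ∧ 1 ≤ v) := by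
  constructor
  · rintro ⟨σ, hσ, h⟩
    refine ⟨one_le_of_forall_le_mul_pow (d := 1) le_rfl hu.le hu hσ fun n => ?_,
      one_le_of_forall_le_mul_pow (d := 4) (by norm_num) hv.le hu hσ fun n => ?_⟩
    · simpa using h 1 (1 * (n + 1)) (by lia)
    · have hI : Complex.I ^ (4 * (n + 1)) = 1 := by rw [pow_mul, Complex.I_pow_four, one_pow]
      simpa [hI] using h Complex.I (4 * (n + 1)) (by lia)
  · rintro ⟨hu1, hv1⟩
    refine ⟨u + v, by positivity, fun z k _ => ?_⟩
    have hz : ‖z‖ ≤ u * |z.re| + v * |z.im| := by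
      nlinarith [Complex.norm_le_abs_re_add_abs_im z, abs_nonneg z.re, abs_nonneg z.im]
    calc u * |(z ^ k).re| + v * |(z ^ k).im|
        ≤ u * ‖z ^ k‖ + v * ‖z ^ k‖ := by
          gcongr
          · exact Complex.abs_re_le_norm _
          · exact Complex.abs_im_le_norm _
      _ = (u + v) * ‖z‖ ^ k := by rw [norm_pow]; ring
      _ ≤ (u + v) * (u * |z.re| + v * |z.im|) ^ k := by gcongr
end

section
/- Let g be a stable subnorm on the quaternions ℍ, and suppose g is equivalent to some continuous subnorm f on ℍ, i.e. there exist μ > 0 and ν > 0 with μ·f(q) ≤ g(q) ≤ ν·f(q) for all q ∈ ℍ. Then g is radially dominant: g(q) ≥ ‖q‖ for all q ∈ ℍ. -/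
/-- A continuous, absolutely homogeneous, positive function on a finite-dimensional real normed
space is bounded below by a positive multiple of the norm. -/
theorem exists_pos_mul_norm_le_of_continuous_of_homogeneous
    {E : Type*} [NormedAddCommGroup E] [NormedSpace ℝ E] [ProperSpace E]
    {f : E → ℝ} (hf_cont : Continuous f) (hf_pos : ∀ x, x ≠ 0 → 0 < f x)
    (hf_hom : ∀ (α : ℝ) (x : E), f (α • x) = |α| * f x) :
    ∃ m : ℝ, 0 < m ∧ ∀ x, m * ‖x‖ ≤ f x := by
  obtain ⟨m, hm, hmf⟩ := (isCompact_sphere (0 : E) 1).exists_forall_le'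
    (f := f) (a := 0) hf_cont.continuousOn
    fun x hx => hf_pos x (ne_zero_of_mem_unit_sphere ⟨x, hx⟩)
  refine ⟨m, hm, fun x => ?_⟩
  rcases eq_or_ne x 0 with rfl | hx
  · simpa using (hf_hom 0 0).ge
  · have hn : 0 < ‖x‖ := norm_pos_iff.mpr hx
    have h := hmf (‖x‖⁻¹ • x) (by simp [norm_smul, hn.ne'])
    rwa [hf_hom, abs_of_pos (inv_pos.mpr hn), inv_mul_eq_div, le_div_iff₀ hn] at h

/-- If `c * a ^ k ≤ σ * b ^ k` for all `k ≥ 1`, with `c` and `b` positive, then `a ≤ b`. -/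
theorem le_of_forall_mul_pow_le_mul_pow {a b c σ : ℝ} (hb : 0 < b) (hc : 0 < c)
    (h : ∀ k : ℕ, 1 ≤ k → c * a ^ k ≤ σ * b ^ k) : a ≤ b := by
  by_contra! hab
  have hr : 1 < a / b := (one_lt_div hb).mpr hab
  obtain ⟨k, hk⟩ := pow_unbounded_of_one_lt (σ / c) hr
  have hk' := hk.trans (pow_lt_pow_right₀ hr k.lt_succ_self)
  rw [div_pow, div_lt_div_iff₀ hc (pow_pos hb _), mul_comm _ c] at hk'
  exact (h (k + 1) (Nat.succ_pos k)).not_gt hk'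


/-- A stable subnorm on the quaternions which is equivalent to a continuous
subnorm is radially dominant: it majorizes the Euclidean norm. -/
theorem stable_equiv_subnorm_radially_dominant
    (g f : Quaternion ℝ → ℝ)
    (hg_pos : ∀ q : Quaternion ℝ, q ≠ 0 → 0 < g q)
    (hg_hom : ∀ (α : ℝ) (q : Quaternion ℝ), g (α • q) = |α| * g q)
    (hg_stable : ∃ σ : ℝ, 0 < σ ∧
      ∀ (q : Quaternion ℝ) (k : ℕ), 1 ≤ k → g (q ^ k) ≤ σ * g q ^ k)
    (hf_cont : Continuous f)
    (hf_pos : ∀ q : Quaternion ℝ, q ≠ 0 → 0 < f q)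
    (hf_hom : ∀ (α : ℝ) (q : Quaternion ℝ), f (α • q) = |α| * f q)
    (μ ν : ℝ) (hμ : 0 < μ) (hν : 0 < ν)
    (h_equiv : ∀ q : Quaternion ℝ, μ * f q ≤ g q ∧ g q ≤ ν * f q) :
    ∀ q : Quaternion ℝ, ‖q‖ ≤ g q := by
  obtain ⟨m, hm, hmf⟩ :=
    exists_pos_mul_norm_le_of_continuous_of_homogeneous hf_cont hf_pos hf_hom
  obtain ⟨σ, -, hσ⟩ := hg_stable
  intro q
  rcases eq_or_ne q 0 with rfl | hq
  · simpa using (hg_hom 0 0).ge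
  · refine le_of_forall_mul_pow_le_mul_pow (σ := σ) (hg_pos q hq) (mul_pos hμ hm) fun k hk => ?_
    calc μ * m * ‖q‖ ^ k = μ * (m * ‖q ^ k‖) := by rw [norm_pow, mul_assoc]
      _ ≤ μ * f (q ^ k) := by gcongr; exact hmf _
      _ ≤ g (q ^ k) := (h_equiv _).1
      _ ≤ σ * g q ^ k := hσ q k hk
end

section
/- Let f be a continuous stable subnorm on ℂ (as a real algebra), let φ : ℝ → ℝ be additive and π-periodic, and set g_φ(z) = f(z)·e^{φ(Arg z)}. Then g_φ is a stable subnorm on ℂ: there exists σ > 0 such that g_φ(z^k) ≤ σ·g_φ(z)^k for all z ∈ ℂ and all integers k ≥ 1. -/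
theorem coe_angle_Arg2pi (z : ℂ) : (Arg2pi z : Real.Angle) = (Complex.arg z : Real.Angle) := by
  unfold Arg2pi
  split_ifs <;> simp

theorem AddMonoidHom.eq_of_coe_angle_eq (φ : ℝ →+ ℝ) (hφ : φ Real.pi = 0) {x y : ℝ}
    (h : (x : Real.Angle) = (y : Real.Angle)) : φ x = φ y := by
  obtain ⟨n, hn⟩ := Real.Angle.angle_eq_iff_two_pi_dvd_sub.1 h
  have hxy : x - y = (2 * n) • Real.pi := by
    rw [hn, zsmul_eq_mul]
    push_cast
    ring
  rw [← sub_eq_zero, ← map_sub, hxy, map_zsmul, hφ, smul_zero]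

theorem AddMonoidHom.map_Arg2pi_pow (φ : ℝ →+ ℝ) (hφ : φ Real.pi = 0) (z : ℂ) (k : ℕ) :
    φ (Arg2pi (z ^ k)) = k * φ (Arg2pi z) := by
  have h : (Arg2pi (z ^ k) : Real.Angle) = ((k • Arg2pi z : ℝ) : Real.Angle) := by
    rw [Real.Angle.coe_nsmul, coe_angle_Arg2pi, coe_angle_Arg2pi, Complex.arg_pow_coe_angle]
  rw [φ.eq_of_coe_angle_eq hφ h, map_nsmul, nsmul_eq_mul]

/-- If `f` is a continuous stable subnorm on `ℂ` and `φ : ℝ → ℝ` is additive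
and `π`-periodic, then `g_φ(z) = f(z)·e^{φ(Arg z)}` is a stable subnorm. -/
theorem g_phi_stable (f : ℂ → ℝ)
    (hf_cont : Continuous f)
    (hf_pos : ∀ z : ℂ, z ≠ 0 → 0 < f z)
    (hf_hom : ∀ (α : ℝ) (z : ℂ), f (α • z) = |α| * f z)
    (hf_stable : ∃ σ : ℝ, 0 < σ ∧ ∀ (z : ℂ) (k : ℕ), 1 ≤ k → f (z ^ k) ≤ σ * f z ^ k)
    (φ : ℝ → ℝ)
    (hφ_add : ∀ x y : ℝ, φ (x + y) = φ x + φ y)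
    (hφ_per : ∀ x : ℝ, φ (x + Real.pi) = φ x) :
    ∃ σ : ℝ, 0 < σ ∧ ∀ (z : ℂ) (k : ℕ), 1 ≤ k →
      f (z ^ k) * Real.exp (φ (Arg2pi (z ^ k)))
        ≤ σ * (f z * Real.exp (φ (Arg2pi z))) ^ k := by
  obtain ⟨σ, hσ, hfσ⟩ := hf_stable
  have hφ_pi : AddMonoidHom.mk' φ hφ_add Real.pi = 0 := by
    have h := hφ_add 0 Real.pi
    rw [hφ_per 0] at h
    simpa using h
  refine ⟨σ, hσ, fun z k hk => ?_⟩
  have harg : φ (Arg2pi (z ^ k)) = k * φ (Arg2pi z) :=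
    (AddMonoidHom.mk' φ hφ_add).map_Arg2pi_pow hφ_pi z k
  rw [harg, Real.exp_nat_mul, mul_pow, ← mul_assoc]
  gcongr
  exact hfσ z k hk
end

section
/- The Euclidean norm is the only continuous submodulus on the quaternions: if f : ℍ → ℝ is continuous, satisfies f(q) > 0 for all q ≠ 0, f(α • q) = |α|·f(q) for all α ∈ ℝ and q ∈ ℍ, and f(q^k) = f(q)^k for all q ∈ ℍ and all integers k ≥ 1, then f(q) = ‖q‖ for all q ∈ ℍ. -/
/-- A positive real number whose powers stay between two positive constants equals `1`. -/
theorem eq_one_of_pow_mem_Icc {x m M : ℝ} (hx : 0 < x) (hm : 0 < m)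
    (h : ∀ k : ℕ, 1 ≤ k → x ^ k ∈ Set.Icc m M) : x = 1 := by
  rcases lt_trichotomy x 1 with hlt | heq | hgt
  · obtain ⟨n, hn⟩ := exists_pow_lt_of_lt_one hm hlt
    have h₁ := (h (n + 1) (by omega)).1
    have h₂ : x ^ (n + 1) ≤ x ^ n := pow_le_pow_of_le_one hx.le hlt.le n.le_succ
    linarith
  · exact heq
  · obtain ⟨n, hn⟩ := pow_unbounded_of_one_lt M hgt
    have h₁ := (h (n + 1) (by omega)).2
    have h₂ : x ^ n ≤ x ^ (n + 1) := pow_le_pow_right₀ hgt.le n.le_succ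
    linarith

/-- A continuous power-multiplicative function that is positive away from `0` takes the value `1`
on the unit sphere of a proper normed division ring. -/
theorem eq_one_of_norm_eq_one_of_map_pow {A : Type*} [NormedDivisionRing A] [ProperSpace A]
    {f : A → ℝ} (hf_cont : Continuous f) (hf_pos : ∀ a, a ≠ 0 → 0 < f a)
    (hf_pow : ∀ (a : A) (k : ℕ), 1 ≤ k → f (a ^ k) = f a ^ k) {a : A} (ha : ‖a‖ = 1) :
    f a = 1 := by
  have hne : ∀ b : A, ‖b‖ = 1 → b ≠ 0 := fun b hb => norm_ne_zero_iff.mp (by simp [hb])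
  have hcomp : IsCompact (Metric.sphere (0 : A) 1) := isCompact_sphere 0 1
  have hnonempty : (Metric.sphere (0 : A) 1).Nonempty := ⟨a, by simpa using ha⟩
  obtain ⟨b, hb, hmin⟩ := hcomp.exists_isMinOn hnonempty hf_cont.continuousOn
  obtain ⟨c, -, hmax⟩ := hcomp.exists_isMaxOn hnonempty hf_cont.continuousOn
  refine eq_one_of_pow_mem_Icc (m := f b) (M := f c) (hf_pos a (hne a ha))
    (hf_pos b (hne b (by simpa using hb))) fun k hk => ?_
  have hmem : a ^ k ∈ Metric.sphere (0 : A) 1 := by simp [norm_pow, ha]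
  rw [← hf_pow a k hk]
  exact ⟨hmin hmem, hmax hmem⟩

/-- The Euclidean norm is the only continuous submodulus on the quaternions. -/
theorem unique_continuous_submodulus_quaternion (f : Quaternion ℝ → ℝ)
    (hf_cont : Continuous f)
    (hf_pos : ∀ q : Quaternion ℝ, q ≠ 0 → 0 < f q)
    (hf_hom : ∀ (α : ℝ) (q : Quaternion ℝ), f (α • q) =|α| * f q)
    (hf_pow : ∀ (q : Quaternion ℝ) (k : ℕ), 1 ≤ k → f (q ^ k) = f q ^ k) :
    ∀ q : Quaternion ℝ, f q = ‖q‖ := by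
  intro q
  rcases eq_or_ne q 0 with rfl | hq
  · simpa using hf_hom 0 0
  · have : ProperSpace (Quaternion ℝ) := FiniteDimensional.proper ℝ _
    have hq' : ‖q‖ ≠ 0 := norm_ne_zero_iff.mpr hq
    have hunit : ‖‖q‖⁻¹ • q‖ = 1 := by
      rw [norm_smul, norm_inv, norm_norm, inv_mul_cancel₀ hq']
    have hone := eq_one_of_norm_eq_one_of_map_pow hf_cont hf_pos hf_pow hunit
    rw [← smul_inv_smul₀ hq' q, hf_hom, hone, smul_inv_smul₀ hq' q, abs_norm, mul_one]
end

section
/- Every solution of the power equation on the quaternions is nonnegative: if f : ℍ → ℝ satisfies f(q^k) = f(q)^k for all q ∈ ℍ and all integers k ≥ 1, then f(q) ≥ 0 for all q ∈ ℍ. -/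
/-- A quaternion is a square as soon as its components satisfy the squaring equations. -/
theorem Quaternion.exists_sq_eq_of_components {q : Quaternion ℝ} (x y z w : ℝ)
    (hre : x ^ 2 - y ^ 2 - z ^ 2 - w ^ 2 = q.re) (hi : 2 * x * y = q.imI)
    (hj : 2 * x * z = q.imJ) (hk : 2 * x * w = q.imK) : ∃ p : Quaternion ℝ, p ^ 2 = q := by
  obtain ⟨p, h1, h2, h3, h4⟩ : ∃ p : Quaternion ℝ,
      p.re = x ∧ p.imI = y ∧ p.imJ = z ∧ p.imK = w := ⟨⟨x, y, z, w⟩, rfl, rfl, rfl, rfl⟩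
  refine ⟨p, ?_⟩
  rw [sq]
  apply Quaternion.ext
  · rw [Quaternion.re_mul, h1, h2, h3, h4]; linarith
  · rw [Quaternion.imI_mul, h1, h2, h3, h4]; linarith
  · rw [Quaternion.imJ_mul, h1, h2, h3, h4]; linarith
  · rw [Quaternion.imK_mul, h1, h2, h3, h4]; linarith

/-- Every real quaternion has a square root. -/
theorem Quaternion.exists_sq_eq (q : Quaternion ℝ) : ∃ p : Quaternion ℝ, p ^ 2 = q := by
  obtain ⟨a, b, c, d⟩ := q
  have hn : 0 ≤ a ^ 2 + b ^ 2 + c ^ 2 + d ^ 2 := by positivity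
  obtain ⟨r, hr, hr2⟩ : ∃ r : ℝ, 0 ≤ r ∧ r ^ 2 = a ^ 2 + b ^ 2 + c ^ 2 + d ^ 2 :=
    ⟨_, Real.sqrt_nonneg _, Real.sq_sqrt hn⟩
  rcases lt_or_ge 0 (a + r) with h | h
  · obtain ⟨t, ht, ht2⟩ : ∃ t : ℝ, 0 < t ∧ t ^ 2 = 2 * (a + r) :=
      ⟨_, Real.sqrt_pos.2 (by linarith), Real.sq_sqrt (by linarith)⟩
    refine exists_sq_eq_of_components ((a + r) / t) (b / t) (c / t) (d / t) ?_ ?_ ?_ ?_ <;>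
      field_simp <;> rw [ht2] <;> linarith
  · have hv : b ^ 2 + c ^ 2 + d ^ 2 ≤ 0 := by nlinarith
    have hb : b = 0 := by nlinarith [sq_nonneg b, sq_nonneg c, sq_nonneg d]
    have hc : c = 0 := by nlinarith [sq_nonneg b, sq_nonneg c, sq_nonneg d]
    have hd : d = 0 := by nlinarith [sq_nonneg b, sq_nonneg c, sq_nonneg d]
    have hs : √(-a) ^ 2 = -a := Real.sq_sqrt (by linarith)
    refine exists_sq_eq_of_components 0 √(-a) 0 0 ?_ ?_ ?_ ?_ <;> simp [hs, hb, hc, hd]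

/-- Every solution of the power equation on the quaternions is nonnegative. -/
theorem power_equation_nonneg_quaternion (f : Quaternion ℝ → ℝ)
    (hf_pow : ∀ (q : Quaternion ℝ) (k : ℕ), 1 ≤ k → f (q ^ k) = f q ^ k) :
    ∀ q : Quaternion ℝ, 0 ≤ f q := by
  intro q
  obtain ⟨p, rfl⟩ := q.exists_sq_eq
  rw [hf_pow p 2 one_le_two]
  exact sq_nonneg _
end
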